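/- Assume ω is symmetric and 2·d_{k−1} < m. Let (V_0,…,V_{k−1}) and (V′_0,…,V′_{k−1}) be two isotropic partial flags of type d in V. Then there exists a linear automorphism g of V with ω(g(v), g(w)) = ω(v,w) for all v,w ∈ V and with determinant 1, such that g(V_p) = V′_p for all p = 0,…,k−1. In other words, the special orthogonal group SO(V,ω) acts transitively on the set of isotropic partial flags of type d whenever d_{k−1} < m/2. -/

import Mathlib

open Module Submodule

/-- Isometries with determinant `±1`. -/
def IsO {V : Type*} [AddCommGroup V] [Module ℂ V] (ω : V →ₗ[ℂ] V →ₗ[ℂ] ℂ) (g : V ≃ₗ[ℂ] V) : Prop :=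
  (∀ v w, ω (g v) (g w) = ω v w) ∧
    (LinearMap.det (g : V →ₗ[ℂ] V) = 1 ∨ LinearMap.det (g : V →ₗ[ℂ] V) = -1)

lemma det_trans_aux {V : Type*} [AddCommGroup V] [Module ℂ V] (g h : V ≃ₗ[ℂ] V) :
    LinearMap.det ((g.trans h : V ≃ₗ[ℂ] V) : V →ₗ[ℂ] V) =
      LinearMap.det (h : V →ₗ[ℂ] V) * LinearMap.det (g : V →ₗ[ℂ] V) := by
  rw [← LinearMap.det_comp]; rfl

lemma IsO.trans {V : Type*} [AddCommGroup V] [Module ℂ V] {ω : V →ₗ[ℂ] V →ₗ[ℂ] ℂ}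
    {g h : V ≃ₗ[ℂ] V} (hg : IsO ω g) (hh : IsO ω h) : IsO ω (g.trans h) := by
  refine ⟨fun v w => by simp [hg.1, hh.1], ?_⟩
  rw [det_trans_aux]
  rcases hg.2 with a | a <;> rcases hh.2 with b | b <;> simp [a, b]

lemma map_fix {V : Type*} [AddCommGroup V] [Module ℂ V] (g : V ≃ₗ[ℂ] V) (E : Submodule ℂ V)
    (h : ∀ x ∈ E, g x = x) : E.map (g : V →ₗ[ℂ] V) = E := by
  ext y
  simp only [Submodule.mem_map, LinearEquiv.coe_coe]
  constructor
  · rintro ⟨x, hx, rfl⟩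
    rwa [h x hx]
  · exact fun hy => ⟨y, hy, h y hy⟩

lemma map_trans_aux {V : Type*} [AddCommGroup V] [Module ℂ V] (g h : V ≃ₗ[ℂ] V)
    (E : Submodule ℂ V) : E.map ((g.trans h : V ≃ₗ[ℂ] V) : V →ₗ[ℂ] V) =
      (E.map (g : V →ₗ[ℂ] V)).map (h : V →ₗ[ℂ] V) := by
  rw [← Submodule.map_comp]; rfl

/-- Reflections. -/
lemma exists_refl {V : Type*} [AddCommGroup V] [Module ℂ V] [FiniteDimensional ℂ V]
    (ω : V →ₗ[ℂ] V →ₗ[ℂ] ℂ) (hsym : ∀ v w, ω v w = ω w v) (c : V) (hc : ω c c ≠ 0) :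
    ∃ g : V ≃ₗ[ℂ] V, (∀ v w, ω (g v) (g w) = ω v w) ∧
      LinearMap.det (g : V →ₗ[ℂ] V) = -1 ∧ ∀ x, g x = x - (2 / ω c c * ω c x) • c := by
  have h2 : ((2 / ω c c) • ω c) c = 2 := by
    simp only [LinearMap.smul_apply, smul_eq_mul]; field_simp
  have happ : ∀ x, Module.reflection h2 x = x - (2 / ω c c * ω c x) • c := by
    intro x
    rw [Module.reflection_apply]; simp
  refine ⟨Module.reflection h2, ?_, ?_, happ⟩
  · intro v w
    rw [happ, happ]
    simp only [map_sub, map_smul, LinearMap.sub_apply, LinearMap.smul_apply, smul_eq_mul]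
    rw [hsym v c]
    field_simp
    ring
  · have : (Module.reflection h2 : V →ₗ[ℂ] V) =
        LinearMap.transvection (-((2 / ω c c) • ω c)) c := by
      ext x
      simp [happ, LinearMap.transvection.apply, sub_eq_add_neg]
    rw [this, LinearMap.transvection.det]
    simp only [LinearMap.neg_apply, h2]
    norm_num

/-- move `u` to `v` when `ω u v ≠ 0`. -/
lemma move_one {V : Type*} [AddCommGroup V] [Module ℂ V] [FiniteDimensional ℂ V]
    (ω : V →ₗ[ℂ] V →ₗ[ℂ] ℂ) (hsym : ∀ v w, ω v w = ω w v) (E : Submodule ℂ V) (u v : V)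
    (hu : ω u u = 0) (hv : ω v v = 0) (huE : ∀ x ∈ E, ω u x = 0) (hvE : ∀ x ∈ E, ω v x = 0)
    (huv : ω u v ≠ 0) : ∃ g : V ≃ₗ[ℂ] V, IsO ω g ∧ (∀ x ∈ E, g x = x) ∧ g u = v := by
  have hc : ω (u - v) (u - v) = -2 * ω u v := by
    simp only [map_sub, LinearMap.sub_apply, hu, hv, hsym v u]; ring
  obtain ⟨g, h1, h2, h3⟩ := exists_refl ω hsym (u - v) (by rw [hc]; simpa using huv)
  refine ⟨g, ⟨h1, Or.inr h2⟩, fun x hx => ?_, ?_⟩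
  · rw [h3]; simp [huE x hx, hvE x hx]
  · rw [h3, hc]
    have : 2 / (-2 * ω u v) * ω (u - v) u = 1 := by
      simp only [map_sub, LinearMap.sub_apply, hu, hsym v u]
      field_simp
      ring
    rw [this]; simp

lemma exists_perp {V : Type*} [AddCommGroup V] [Module ℂ V] [FiniteDimensional ℂ V]
    (ω : V →ₗ[ℂ] V →ₗ[ℂ] ℂ) (hnd : ∀ v, (∀ w, ω v w = 0) → v = 0)
    (hsym : ∀ v w, ω v w = ω w v) (E : Submodule ℂ V) (u : V) (hu : u ∉ E) :
    ∃ a, (∀ x ∈ E, ω a x = 0) ∧ ω u a ≠ 0 := by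
  by_contra! hcon
  have hB : LinearMap.BilinForm.Nondegenerate ω :=
    ⟨hnd, fun v h => hnd v fun w => by rw [hsym]; exact h w⟩
  have hR : LinearMap.BilinForm.IsRefl ω := fun x y h => by rw [hsym]; exact h
  apply hu
  rw [← LinearMap.BilinForm.orthogonal_orthogonal hB hR E]
  intro a ha
  change ω a u = 0
  rw [hsym]
  exact hcon a fun x hx => by rw [hsym]; exact ha x hx

lemma move_two {V : Type*} [AddCommGroup V] [Module ℂ V] [FiniteDimensional ℂ V]
    (ω : V →ₗ[ℂ] V →ₗ[ℂ] ℂ) (hnd : ∀ v, (∀ w, ω v w = 0) → v = 0)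
    (hsym : ∀ v w, ω v w = ω w v) (E : Submodule ℂ V) (u v : V)
    (hu : ω u u = 0) (hv : ω v v = 0) (huE : ∀ x ∈ E, ω u x = 0) (hvE : ∀ x ∈ E, ω v x = 0)
    (hu' : u ∉ E) (hv' : v ∉ E) :
    ∃ g : V ≃ₗ[ℂ] V, IsO ω g ∧ (∀ x ∈ E, g x = x) ∧ g u = v := by
  by_cases huv : ω u v = 0
  swap
  · exact move_one ω hsym E u v hu hv huE hvE huv
  have hw : ∃ w, (∀ x ∈ E, ω w x = 0) ∧ ω u w ≠ 0 ∧ ω v w ≠ 0 := by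
    obtain ⟨a, ha, hua⟩ := exists_perp ω hnd hsym E u hu'
    obtain ⟨b, hb, hvb⟩ := exists_perp ω hnd hsym E v hv'
    by_cases h1 : ω v a = 0
    swap
    · exact ⟨a, ha, hua, h1⟩
    by_cases h2 : ω u b = 0
    swap
    · exact ⟨b, hb, h2, hvb⟩
    exact ⟨a + b, fun x hx => by simp [ha x hx, hb x hx], by simpa [h2] using hua,
      by simpa [h1] using hvb⟩
  obtain ⟨w, hwE, huw, hvw⟩ := hw
  obtain ⟨t, ht⟩ : ∃ t : ℂ, ω w w + 2 * t * ω u w = 0 :=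
    ⟨-ω w w / (2 * ω u w), by field_simp; ring⟩
  have hz : ω (w + t • u) (w + t • u) = 0 := by
    simp only [map_add, map_smul, LinearMap.add_apply, LinearMap.smul_apply, smul_eq_mul, hu,
      hsym w u]
    linear_combination ht
  have hzE : ∀ x ∈ E, ω (w + t • u) x = 0 := fun x hx => by simp [hwE x hx, huE x hx]
  obtain ⟨g, g1, g2, g3⟩ := move_one ω hsym E u (w + t • u) hu hz huE hzE (by simpa [hu] using huw)
  obtain ⟨h, h1, h2, h3⟩ := move_one ω hsym E (w + t • u) v hz hv hzE hvE
    (by rw [hsym]; simpa [hsym v u, huv] using hvw)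
  exact ⟨g.trans h, g1.trans h1, fun x hx => by simp [g2 x hx, h2 x hx], by simp [g3, h3]⟩

lemma move_sub {V : Type*} [AddCommGroup V] [Module ℂ V] [FiniteDimensional ℂ V]
    (ω : V →ₗ[ℂ] V →ₗ[ℂ] ℂ) (hnd : ∀ v, (∀ w, ω v w = 0) → v = 0)
    (hsym : ∀ v w, ω v w = ω w v) (n : ℕ) : ∀ (E W W' : Submodule ℂ V), E ≤ W → E ≤ W' →
    (∀ v ∈ W, ∀ w ∈ W, ω v w = 0) → (∀ v ∈ W', ∀ w ∈ W', ω v w = 0) →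
    finrank ℂ W = finrank ℂ W' → finrank ℂ W ≤ finrank ℂ E + n →
    ∃ g : V ≃ₗ[ℂ] V, IsO ω g ∧ (∀ x ∈ E, g x = x) ∧ W.map (g : V →ₗ[ℂ] V) = W' := by
  induction n with
  | zero =>
    intro E W W' hE hE' _ _ hd hn
    have h1 : E = W := Submodule.eq_of_le_of_finrank_le hE (by omega)
    have h2 : E = W' := Submodule.eq_of_le_of_finrank_le hE' (by omega)
    refine ⟨LinearEquiv.refl ℂ V, ⟨fun _ _ => rfl, Or.inl ?_⟩, fun _ _ => rfl, ?_⟩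
    · simp
    · rw [← h1, ← h2]; exact map_fix _ _ fun _ _ => rfl
  | succ n ih =>
    intro E W W' hE hE' hW hW' hd hn
    by_cases hlt : finrank ℂ W ≤ finrank ℂ E + n
    · exact ih E W W' hE hE' hW hW' hd hlt
    have e1 : ∃ u ∈ W, u ∉ E := by
      by_contra! hcon
      have := Submodule.finrank_mono (show W ≤ E from hcon)
      omega
    have e2 : ∃ u ∈ W', u ∉ E := by
      by_contra! hcon
      have := Submodule.finrank_mono (show W' ≤ E from hcon)
      omega
    obtain ⟨u, huW, huE⟩ := e1
    obtain ⟨v, hvW, hvE⟩ := e2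
    obtain ⟨h, h1, h2, h3⟩ := move_two ω hnd hsym E u v (hW u huW u huW) (hW' v hvW v hvW)
      (fun x hx => hW u huW x (hE hx)) (fun x hx => hW' v hvW x (hE' hx)) huE hvE
    have hfr : finrank ℂ (W.map (h : V →ₗ[ℂ] V)) = finrank ℂ W := LinearEquiv.finrank_map_eq h W
    have hlt' : finrank ℂ E < finrank ℂ (E ⊔ span ℂ {v} : Submodule ℂ V) := by
      apply Submodule.finrank_lt_finrank_of_lt
      refine lt_of_le_of_ne le_sup_left fun heq => hvE ?_
      rw [heq]
      exact Submodule.mem_sup_right (Submodule.mem_span_singleton_self v)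
    obtain ⟨g, g1, g2, g3⟩ := ih (E ⊔ span ℂ {v}) (W.map (h : V →ₗ[ℂ] V)) W'
      (sup_le (fun x hx => ⟨x, hE hx, h2 x hx⟩)
        ((Submodule.span_singleton_le_iff_mem _ _).2 ⟨u, huW, h3⟩))
      (sup_le hE' ((Submodule.span_singleton_le_iff_mem _ _).2 hvW))
      (by
        rintro _ ⟨x, hx, rfl⟩ _ ⟨y, hy, rfl⟩
        exact (h1.1 x y).trans (hW x hx y hy))
      hW' (by omega) (by omega)
    refine ⟨h.trans g, h1.trans g1, fun x hx => ?_, ?_⟩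
    · simp [h2 x hx, g2 x (Submodule.mem_sup_left hx)]
    · rw [map_trans_aux, g3]

/-- If `ω` is symmetric and `2·d_{k−1} < m`, the special orthogonal group
`SO(V,ω)` acts transitively on the set of isotropic partial flags of type `d`. -/
theorem stmt_4 (V : Type*) [AddCommGroup V] [Module ℂ V] [FiniteDimensional ℂ V]
    (m : ℕ) (hdimV : finrank ℂ V = m)
    (ω : V →ₗ[ℂ] V →ₗ[ℂ] ℂ)
    (hnd : ∀ v, (∀ w, ω v w = 0) → v = 0)
    (hsym : ∀ v w, ω v w = ω w v)
    (k : ℕ) (hk : 2 ≤ k)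
    (d : Fin k → ℕ) (hd0 : d ⟨0, by omega⟩ = 0) (hdsm : StrictMono d)
    (hdm : 2 * d ⟨k - 1, by omega⟩ < m)
    (F F' : Fin k → Submodule ℂ V)
    (hFmono : Monotone F) (hF'mono : Monotone F')
    (hFiso : ∀ p, ∀ v ∈ F p, ∀ w ∈ F p, ω v w = 0)
    (hF'iso : ∀ p, ∀ v ∈ F' p, ∀ w ∈ F' p, ω v w = 0)
    (hFdim : ∀ p, finrank ℂ (F p) = d p) (hF'dim : ∀ p, finrank ℂ (F' p) = d p) :
    ∃ g : V ≃ₗ[ℂ] V, (∀ v w, ω (g v) (g w) = ω v w) ∧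
      LinearMap.det (g : V →ₗ[ℂ] V) = 1 ∧
      ∀ p, (F p).map (g : V →ₗ[ℂ] V) = F' p := by
  have key : ∀ j : ℕ, j < k → ∃ g : V ≃ₗ[ℂ] V, IsO ω g ∧
      ∀ p : Fin k, p.val ≤ j → (F p).map (g : V →ₗ[ℂ] V) = F' p := by
    intro j
    induction j with
    | zero =>
      intro _
      refine ⟨LinearEquiv.refl ℂ V, ⟨fun _ _ => rfl, Or.inl (by simp)⟩, fun p hp => ?_⟩
      have hp0 : p = ⟨0, by omega⟩ := Fin.ext (by simpa using hp)
      have a : F p = ⊥ := Submodule.finrank_eq_zero.1 (by rw [hFdim, hp0, hd0])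
      have b : F' p = ⊥ := Submodule.finrank_eq_zero.1 (by rw [hF'dim, hp0, hd0])
      rw [a, b, Submodule.map_bot]
    | succ j ih =>
      intro hj
      obtain ⟨g, g1, g2⟩ := ih (by omega)
      have hle : (⟨j, by omega⟩ : Fin k) ≤ ⟨j + 1, hj⟩ := by simp [Fin.le_def]
      obtain ⟨h, h1, h2, h3⟩ := move_sub ω hnd hsym (finrank ℂ V) (F' ⟨j, by omega⟩)
        ((F ⟨j + 1, hj⟩).map (g : V →ₗ[ℂ] V)) (F' ⟨j + 1, hj⟩)
        (by rw [← g2 ⟨j, by omega⟩ le_rfl]; exact Submodule.map_mono (hFmono hle))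
        (hF'mono hle)
        (by
          rintro _ ⟨x, hx, rfl⟩ _ ⟨y, hy, rfl⟩
          exact (g1.1 x y).trans (hFiso _ x hx y hy))
        (hF'iso _)
        (by rw [LinearEquiv.finrank_map_eq g, hFdim, hF'dim])
        ((Submodule.finrank_le _).trans (by omega))
      refine ⟨g.trans h, g1.trans h1, fun p hp => ?_⟩
      rw [map_trans_aux]
      rcases Nat.lt_or_ge j p.val with hlt | hge
      · have : p = ⟨j + 1, hj⟩ := Fin.ext (by simp; omega)
        rw [this, h3]
      · rw [g2 p hge]
        exact map_fix _ _ fun x hx => h2 x (hF'mono (show p ≤ ⟨j, by omega⟩ from hge) hx)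
  obtain ⟨g, g1, g2⟩ := key (k - 1) (by omega)
  rcases g1.2 with hdet | hdet
  · exact ⟨g, g1.1, hdet, fun p => g2 p (by omega)⟩
  have hB : LinearMap.BilinForm.Nondegenerate ω :=
    ⟨hnd, fun v h => hnd v fun w => by rw [hsym]; exact h w⟩
  have hc : ∃ c, (∀ x ∈ F' ⟨k - 1, by omega⟩, ω c x = 0) ∧ ω c c ≠ 0 := by
    by_contra! hcon
    have hfr := LinearMap.BilinForm.finrank_orthogonal hB (F' ⟨k - 1, by omega⟩)
    have hfr2 := LinearMap.BilinForm.finrank_orthogonal hB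
      (LinearMap.BilinForm.orthogonal ω (F' ⟨k - 1, by omega⟩))
    have hle : LinearMap.BilinForm.orthogonal ω (F' ⟨k - 1, by omega⟩) ≤
        LinearMap.BilinForm.orthogonal ω
          (LinearMap.BilinForm.orthogonal ω (F' ⟨k - 1, by omega⟩)) := by
      intro a ha b hb
      change ω b a = 0
      have h0 : ∀ y ∈ LinearMap.BilinForm.orthogonal ω (F' ⟨k - 1, by omega⟩), ω y y = 0 :=
        fun y hy => hcon y fun x hx => by rw [hsym]; exact hy x hx
      have hab := h0 _ (add_mem ha hb)
      simp only [map_add, LinearMap.add_apply, h0 a ha, h0 b hb, hsym a b] at hab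
      have : 2 * ω b a = 0 := by linear_combination hab
      simpa using this
    have := Submodule.finrank_mono hle
    have hF := hF'dim ⟨k - 1, by omega⟩
    omega
  obtain ⟨c, hcE, hcc⟩ := hc
  obtain ⟨r, r1, r2, r3⟩ := exists_refl ω hsym c hcc
  refine ⟨g.trans r, fun v w => by simp [g1.1, r1], ?_, fun p => ?_⟩
  · rw [det_trans_aux, hdet, r2]; norm_num
  · rw [map_trans_aux, g2 p (by omega)]
    refine map_fix _ _ fun x hx => ?_
    have hp : p ≤ ⟨k - 1, by omega⟩ := by rw [Fin.le_def]; simp; omega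
    rw [r3, hcE x (hF'mono hp hx)]; simp
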